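/- arXiv:2309.05356 — 2 statements merged into one kernel-verified Lean document; each statement's English description precedes it below -/
import Mathlib

section
/- Let k ≥ 2 and n ≥ k + 2, and let Tₙᵏ be the tadpole graph: the graph of order n obtained from the path P_k by adding a path P_{n−k} and joining both end-vertices of P_{n−k} to the same fixed end-vertex of P_k (so that vertex has degree 3). Then σ₁(Tₙᵏ) = σ₁(P_{k−1})σ₀(P_{n−k}) + σ₁(P_{n−k})σ₀(P_{k−1}) + σ₁(P_{k−2})σ₀(P_{n−k−2}) + σ₁(P_{n−k−2})σ₀(P_{k−2}) + σ₀(P_{k−3})σ₀(P_{n−k−2}) + 2σ₀(P_{k−2})σ₀(P_{n−k−3}), with the conventions σ₁(P_t) = 0 for t ≤ 0 and σ₀(P_t) = 1 for t ≤ 0. -/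
/-- The set of edges of `G` whose endpoints all lie in `S`, i.e. the edges of the
subgraph induced on `S`. -/
def edgesWithin {V : Type*} (G : SimpleGraph V) (S : Set V) : Set (Sym2 V) :=
  {e | e ∈ G.edgeSet ∧ ∀ v ∈ e, v ∈ S}

/-- `sigma1 G` is the number of 1-nearly independent vertex subsets of `G`:
subsets of the vertex set whose induced subgraph has exactly one edge. -/
noncomputable def sigma1 {V : Type*} (G : SimpleGraph V) : ℕ :=
  Nat.card {S : Set V | (edgesWithin G S).ncard = 1}

/-- `sigma0 G` is the number of independent vertex subsets of `G`:
subsets of the vertex set containing no pair of adjacent vertices. -/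
noncomputable def sigma0 {V : Type*} (G : SimpleGraph V) : ℕ :=
  Nat.card {S : Set V | edgesWithin G S = ∅}

/-- The tadpole graph `Tₙᵏ`: the graph of order `n` obtained from the path `P_k`
(on vertices `0, …, k−1`) by adding a path `P_{n−k}` (on vertices `k, …, n−1`) and joining
both end-vertices `k` and `n−1` of that path to the end-vertex `k−1` of `P_k`. -/
def tadpoleGraph (n k : ℕ) : SimpleGraph (Fin n) :=
  SimpleGraph.fromRel
    (fun a b => (a.val + 1 = b.val ∧ b.val < k) ∨ (a.val + 1 = b.val ∧ k ≤ a.val) ∨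
      (a.val = k - 1 ∧ (b.val = k ∨ b.val = n - 1)))

/-- The number of edges of `G` with both endpoints in `S`. -/
noncomputable def inducedEdgeCount {V : Type*} (G : SimpleGraph V) (S : Finset V) : ℕ :=
  (edgesWithin G (S : Set V)).ncard

/-- The number of subsets of `A` spanning exactly `j` edges of `G`. -/
noncomputable def subsetCount {V : Type*} (G : SimpleGraph V) (j : ℕ) (A : Finset V) : ℕ :=
  (A.powerset.filter fun S => inducedEdgeCount G S = j).card

lemma edgesWithin_finite {V : Type*} (G : SimpleGraph V) (S : Finset V) :
    (edgesWithin G (S : Set V)).Finite := by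
  refine S.sym2.finite_toSet.subset fun e he => ?_
  rw [Finset.mem_coe, Finset.mem_sym2_iff]
  exact he.2

lemma mk_mem_edgesWithin {V : Type*} {G : SimpleGraph V} {S : Set V} {a b : V} :
    s(a, b) ∈ edgesWithin G S ↔ G.Adj a b ∧ a ∈ S ∧ b ∈ S := by
  simp [edgesWithin]

lemma sigma1_eq_subsetCount {V : Type*} [Fintype V] (G : SimpleGraph V) :
    sigma1 G = subsetCount G 1 Finset.univ := by
  classical
  have h : {S : Set V | (edgesWithin G S).ncard = 1} = (fun S : Finset V => (S : Set V)) ''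
      ((Finset.univ.powerset.filter fun S => inducedEdgeCount G S = 1 : Finset (Finset V)) :
        Set (Finset V)) := by
    ext S
    obtain ⟨S, rfl⟩ := S.toFinite.exists_finset_coe
    simp [inducedEdgeCount]
  rw [sigma1, Nat.card_coe_set_eq, h, Set.ncard_image_of_injective _ Finset.coe_injective,
    Set.ncard_coe_finset, subsetCount]

lemma sigma0_eq_subsetCount {V : Type*} [Fintype V] (G : SimpleGraph V) :
    sigma0 G = subsetCount G 0 Finset.univ := by
  classical
  have h : {S : Set V | edgesWithin G S = ∅} = (fun S : Finset V => (S : Set V)) ''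
      ((Finset.univ.powerset.filter fun S => inducedEdgeCount G S = 0 : Finset (Finset V)) :
        Set (Finset V)) := by
    ext S
    obtain ⟨S, rfl⟩ := S.toFinite.exists_finset_coe
    simp [inducedEdgeCount, Set.ncard_eq_zero (edgesWithin_finite G S)]
  rw [sigma0, Nat.card_coe_set_eq, h, Set.ncard_image_of_injective _ Finset.coe_injective,
    Set.ncard_coe_finset, subsetCount]

lemma inducedEdgeCount_map {V W : Type*} {H : SimpleGraph W} {G : SimpleGraph V} (f : H ↪g G)
    (S : Finset W) : inducedEdgeCount G (S.map f.toEmbedding) = inducedEdgeCount H S := by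
  have h : edgesWithin G (S.map f.toEmbedding : Set V) =
      Sym2.map f '' edgesWithin H (S : Set W) := by
    ext e
    induction e with | _ a b
    rw [mk_mem_edgesWithin]
    constructor
    · rintro ⟨hab, ha, hb⟩
      simp only [Finset.coe_map, Set.mem_image, Finset.mem_coe] at ha hb
      obtain ⟨a, ha, rfl⟩ := ha
      obtain ⟨b, hb, rfl⟩ := hb
      exact ⟨s(a, b), mk_mem_edgesWithin.2 ⟨f.map_adj_iff.1 hab, ha, hb⟩, rfl⟩
    · rintro ⟨e, he, heq⟩
      induction e with | _ c d
      rw [mk_mem_edgesWithin] at he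
      rw [← mk_mem_edgesWithin (S := (S.map f.toEmbedding : Set V)), ← heq, Sym2.map_mk,
        mk_mem_edgesWithin]
      exact ⟨f.map_adj_iff.2 he.1, by simpa using he.2.1, by simpa using he.2.2⟩
  rw [inducedEdgeCount, h, Set.ncard_image_of_injective _ (Sym2.map.injective f.injective),
    inducedEdgeCount]

lemma subsetCount_map {V W : Type*} {H : SimpleGraph W} {G : SimpleGraph V} (f : H ↪g G)
    (j : ℕ) (A : Finset W) : subsetCount G j (A.map f.toEmbedding) = subsetCount H j A := by
  classical
  have h : ((A.map f.toEmbedding).powerset.filter fun S => inducedEdgeCount G S = j) =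
      (A.powerset.filter fun S => inducedEdgeCount H S = j).map
        (Finset.mapEmbedding f.toEmbedding).toEmbedding := by
    ext S
    simp only [Finset.mem_filter, Finset.mem_powerset, Finset.mem_map, Finset.subset_map_iff]
    constructor
    · rintro ⟨⟨T, hT, rfl⟩, hS⟩
      exact ⟨T, ⟨hT, by rwa [inducedEdgeCount_map] at hS⟩, rfl⟩
    · rintro ⟨T, ⟨hT, hS⟩, rfl⟩
      exact ⟨⟨T, hT, rfl⟩, (inducedEdgeCount_map f T).trans hS⟩
  rw [subsetCount, h, Finset.card_map, subsetCount]

lemma inducedEdgeCount_insert {V : Type*} [DecidableEq V] (G : SimpleGraph V)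
    [DecidableRel G.Adj] {v : V} {S : Finset V} (hv : v ∉ S) :
    inducedEdgeCount G (insert v S) = inducedEdgeCount G S + (S.filter (G.Adj v)).card := by
  have h : edgesWithin G ((insert v S : Finset V) : Set V) = edgesWithin G (S : Set V) ∪
      (fun u => s(v, u)) '' ((S.filter (G.Adj v) : Finset V) : Set V) := by
    ext e
    induction e with | _ a b
    simp only [Set.mem_union, mk_mem_edgesWithin, Set.mem_image, Finset.mem_coe,
      Finset.mem_insert, Finset.mem_filter, Sym2.eq_iff]
    constructor
    · rintro ⟨hab, rfl | ha, rfl | hb⟩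
      · exact absurd hab (G.loopless.irrefl _)
      · exact .inr ⟨b, ⟨hb, hab⟩, .inl ⟨rfl, rfl⟩⟩
      · exact .inr ⟨a, ⟨ha, hab.symm⟩, .inr ⟨rfl, rfl⟩⟩
      · exact .inl ⟨hab, ha, hb⟩
    · rintro (⟨hab, ha, hb⟩ | ⟨u, ⟨hu, hvu⟩, ⟨rfl, rfl⟩ | ⟨rfl, rfl⟩⟩)
      · exact ⟨hab, .inr ha, .inr hb⟩
      · exact ⟨hvu, .inl rfl, .inr hu⟩
      · exact ⟨hvu.symm, .inr hu, .inl rfl⟩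
  have hd : Disjoint (edgesWithin G (S : Set V))
      ((fun u => s(v, u)) '' ((S.filter (G.Adj v) : Finset V) : Set V)) := by
    rw [Set.disjoint_left]
    rintro _ he ⟨u, _, rfl⟩
    exact hv (mk_mem_edgesWithin.1 he).2.1
  rw [inducedEdgeCount, h, Set.ncard_union_eq hd (edgesWithin_finite G S) (Set.toFinite _),
    Set.ncard_image_of_injective _ fun a b hab => Sym2.congr_right.1 hab, Set.ncard_coe_finset,
    inducedEdgeCount]

lemma inducedEdgeCount_union {V : Type*} [DecidableEq V] (G : SimpleGraph V) {A B : Finset V}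
    (hAB : Disjoint A B) (hadj : ∀ a ∈ A, ∀ b ∈ B, ¬ G.Adj a b) :
    inducedEdgeCount G (A ∪ B) = inducedEdgeCount G A + inducedEdgeCount G B := by
  have h : edgesWithin G ((A ∪ B : Finset V) : Set V) =
      edgesWithin G (A : Set V) ∪ edgesWithin G (B : Set V) := by
    ext e
    induction e with | _ a b
    simp only [Set.mem_union, mk_mem_edgesWithin, Finset.mem_coe, Finset.mem_union]
    have h1 := hadj a
    have h2 := hadj b
    have h3 := G.adj_comm a b
    grind
  have hd : Disjoint (edgesWithin G (A : Set V)) (edgesWithin G (B : Set V)) := by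
    rw [Set.disjoint_left]
    intro e
    induction e with | _ a b
    intro h1 h2
    exact Finset.disjoint_left.1 hAB (mk_mem_edgesWithin.1 h1).2.1 (mk_mem_edgesWithin.1 h2).2.1
  rw [inducedEdgeCount, h, Set.ncard_union_eq hd (edgesWithin_finite G A)
    (edgesWithin_finite G B), inducedEdgeCount, inducedEdgeCount]

/-- Splitting a subset of `A ∪ B` with no edges between `A` and `B`. -/
lemma subsetCount_union {V : Type*} [DecidableEq V] (G : SimpleGraph V) (j : ℕ) {A B : Finset V}
    (hAB : Disjoint A B) (hadj : ∀ a ∈ A, ∀ b ∈ B, ¬ G.Adj a b) :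
    subsetCount G j (A ∪ B) =
      ((A.powerset ×ˢ B.powerset).filter fun p =>
        inducedEdgeCount G p.1 + inducedEdgeCount G p.2 = j).card := by
  symm
  refine Finset.card_nbij' (fun p => p.1 ∪ p.2) (fun S => (S ∩ A, S ∩ B)) ?_ ?_ ?_ ?_
  · rintro ⟨S, T⟩ h
    simp only [Finset.coe_filter, Finset.mem_product, Finset.mem_powerset, Set.mem_ofPred_eq] at h ⊢
    obtain ⟨⟨hS, hT⟩, h⟩ := h
    refine ⟨Finset.union_subset_union hS hT, ?_⟩
    rw [inducedEdgeCount_union G (hAB.mono hS hT) fun a ha b hb => hadj a (hS ha) b (hT hb), h]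
  · intro S h
    simp only [Finset.coe_filter, Finset.mem_product, Finset.mem_powerset, Set.mem_ofPred_eq] at h ⊢
    refine ⟨⟨Finset.inter_subset_right, Finset.inter_subset_right⟩, ?_⟩
    rw [← inducedEdgeCount_union G (hAB.mono Finset.inter_subset_right Finset.inter_subset_right),
      ← Finset.inter_union_distrib_left, Finset.inter_eq_left.2 h.1, h.2]
    exact fun a ha b hb => hadj a (Finset.mem_inter.1 ha).2 b (Finset.mem_inter.1 hb).2
  · rintro ⟨S, T⟩ h
    simp only [Finset.coe_filter, Finset.mem_product, Finset.mem_powerset, Set.mem_ofPred_eq] at h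
    have := Finset.disjoint_left.1 hAB
    ext x <;> simp only [Finset.mem_inter, Finset.mem_union] <;> grind
  · intro S h
    simp only [Finset.coe_filter, Finset.mem_powerset, Set.mem_ofPred_eq] at h
    simp only [← Finset.inter_union_distrib_left, Finset.inter_eq_left.2 h.1]

lemma subsetCount_zero_union {V : Type*} [DecidableEq V] (G : SimpleGraph V) {A B : Finset V}
    (hAB : Disjoint A B) (hadj : ∀ a ∈ A, ∀ b ∈ B, ¬ G.Adj a b) :
    subsetCount G 0 (A ∪ B) = subsetCount G 0 A * subsetCount G 0 B := by
  rw [subsetCount_union G 0 hAB hadj, subsetCount, subsetCount, ← Finset.card_product]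
  congr 1
  ext p
  simp only [Finset.mem_filter, Finset.mem_product]
  grind

lemma subsetCount_one_union {V : Type*} [DecidableEq V] (G : SimpleGraph V) {A B : Finset V}
    (hAB : Disjoint A B) (hadj : ∀ a ∈ A, ∀ b ∈ B, ¬ G.Adj a b) :
    subsetCount G 1 (A ∪ B) =
      subsetCount G 1 A * subsetCount G 0 B + subsetCount G 1 B * subsetCount G 0 A := by
  rw [subsetCount_union G 1 hAB hadj, mul_comm (subsetCount G 1 B)]
  simp only [subsetCount]
  rw [← Finset.card_product, ← Finset.card_product, ← Finset.card_union_of_disjoint]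
  · congr 1
    ext p
    simp only [Finset.mem_filter, Finset.mem_product, Finset.mem_union]
    grind
  · rw [Finset.disjoint_left]
    intro p
    simp only [Finset.mem_filter, Finset.mem_product]
    grind

/-- Deletion formula: a subset of `A` spanning one edge either avoids `v`, or contains `v` and none
of its neighbours, or contains `v` and exactly one neighbour `u` of `v`. -/
lemma subsetCount_one_eq {V : Type*} [DecidableEq V] (G : SimpleGraph V) [DecidableRel G.Adj]
    {v : V} {A : Finset V} (hv : v ∈ A) :
    subsetCount G 1 A = subsetCount G 1 (A.erase v) +
      subsetCount G 1 ((A.erase v).filter fun x => ¬ G.Adj v x) +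
      ∑ u ∈ A.filter (G.Adj v), subsetCount G 0
        (A.filter fun x => x ≠ v ∧ ¬ G.Adj v x ∧ x ≠ u ∧ ¬ G.Adj u x) := by
  set N : V → Finset (Finset V) := fun u =>
    ((A.filter fun x => x ≠ v ∧ ¬ G.Adj v x ∧ x ≠ u ∧ ¬ G.Adj u x).powerset.filter
      fun S => inducedEdgeCount G S = 0) with hN
  set F : Finset (Finset V) := ((A.erase v).filter fun x => ¬ G.Adj v x).powerset.filter
    fun S => inducedEdgeCount G S = 1 with hF
  have notMem : ∀ u ∈ A.filter (G.Adj v), ∀ S ∈ N u, v ∉ insert u S ∧ u ∉ S := by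
    intro u hu S hS
    simp only [hN, Finset.mem_filter, Finset.mem_powerset] at hS hu
    refine ⟨fun h => ?_, fun h => ?_⟩
    · rcases Finset.mem_insert.1 h with rfl | h
      · exact G.loopless.irrefl _ hu.2
      · exact (Finset.mem_filter.1 (hS.1 h)).2.1 rfl
    · exact (Finset.mem_filter.1 (hS.1 h)).2.2.2.1 rfl
  have nbrs : ∀ u ∈ A.filter (G.Adj v), ∀ S ∈ N u, (insert u S).filter (G.Adj v) = {u} := by
    intro u hu S hS
    simp only [hN, Finset.mem_filter, Finset.mem_powerset] at hS hu
    ext x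
    have := @hS.1 x
    grind
  have edges : ∀ u ∈ A.filter (G.Adj v), ∀ S ∈ N u, inducedEdgeCount G (insert u S) = 0 := by
    intro u hu S hS
    rw [inducedEdgeCount_insert G (notMem u hu S hS).2, Finset.card_eq_zero.2,
      (Finset.mem_filter.1 hS).2]
    refine Finset.filter_eq_empty_iff.2 fun x hx => ?_
    exact (Finset.mem_filter.1 (Finset.mem_powerset.1 (Finset.mem_filter.1 hS).1 hx)).2.2.2.2
  have split : (A.powerset.filter fun S => inducedEdgeCount G S = 1) =
      ((A.erase v).powerset.filter fun S => inducedEdgeCount G S = 1) ∪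
      (F.image (insert v) ∪
        (A.filter (G.Adj v)).biUnion fun u => (N u).image fun S => insert v (insert u S)) := by
    ext S
    simp only [Finset.mem_union, Finset.mem_image, Finset.mem_biUnion]
    constructor
    · intro hS
      simp only [Finset.mem_filter, Finset.mem_powerset] at hS
      by_cases hvS : v ∈ S
      · right
        have hins := Finset.insert_erase hvS
        have hcount := inducedEdgeCount_insert G (Finset.notMem_erase v S)
        rw [hins, hS.2] at hcount
        rcases Nat.eq_zero_or_pos ((S.erase v).filter (G.Adj v)).card with h0 | h0
        · left
          refine ⟨S.erase v, ?_, hins⟩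
          have h1 := Finset.filter_eq_empty_iff.1 (Finset.card_eq_zero.1 h0)
          simp only [hF, Finset.mem_filter, Finset.mem_powerset]
          refine ⟨fun x hx => Finset.mem_filter.2
            ⟨Finset.erase_subset_erase v hS.1 hx, h1 hx⟩, by omega⟩
        · right
          obtain ⟨u, hu⟩ := Finset.card_eq_one.1
            (show ((S.erase v).filter (G.Adj v)).card = 1 by omega)
          have hu' : u ∈ (S.erase v).filter (G.Adj v) := by simp [hu]
          rw [Finset.mem_filter] at hu'
          have hins' := Finset.insert_erase hu'.1
          have hcount' := inducedEdgeCount_insert G (Finset.notMem_erase u (S.erase v))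
          rw [hins'] at hcount'
          have h0' : (((S.erase v).erase u).filter (G.Adj u)).card = 0 := by omega
          have h1 := Finset.filter_eq_empty_iff.1 (Finset.card_eq_zero.1 h0')
          refine ⟨u, Finset.mem_filter.2 ⟨hS.1 (Finset.mem_of_mem_erase hu'.1), hu'.2⟩,
            (S.erase v).erase u, ?_, by rw [hins', hins]⟩
          simp only [hN, Finset.mem_filter, Finset.mem_powerset]
          refine ⟨fun x hx => ?_, by omega⟩
          have h2 := h1 hx
          have h3 : x ∈ (S.erase v).filter (G.Adj v) ↔ x ∈ ({u} : Finset V) := by rw [hu]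
          have h4 := @hS.1 x
          grind
      · left
        simpa [Finset.subset_erase, hvS] using hS
    · rintro (h | ⟨T, hT, rfl⟩ | ⟨u, hu, T, hT, rfl⟩)
      · exact Finset.filter_subset_filter _ (Finset.powerset_mono.2 (Finset.erase_subset v A)) h
      · simp only [hF, Finset.mem_filter, Finset.mem_powerset] at hT ⊢
        have hvT : v ∉ T := fun h => by simpa using hT.1 h
        refine ⟨Finset.insert_subset hv fun x hx =>
          Finset.mem_of_mem_erase (Finset.mem_filter.1 (hT.1 hx)).1, ?_⟩
        rw [inducedEdgeCount_insert G hvT, hT.2, Finset.card_eq_zero.2]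
        exact Finset.filter_eq_empty_iff.2 fun x hx => (Finset.mem_filter.1 (hT.1 hx)).2
      · rw [Finset.mem_filter, inducedEdgeCount_insert G (notMem u hu T hT).1, nbrs u hu T hT,
          edges u hu T hT, Finset.card_singleton]
        simp only [hN, Finset.mem_filter, Finset.mem_powerset] at hT hu
        refine ⟨Finset.mem_powerset.2 (Finset.insert_subset hv (Finset.insert_subset hu.1
          fun x hx => (Finset.mem_filter.1 (hT.1 hx)).1)), rfl⟩
  have cardF : (F.image (insert v)).card = F.card := by
    refine Finset.card_image_of_injOn fun S hS T hT h => ?_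
    have key : ∀ S ∈ F, v ∉ S := fun S hS h => by
      simpa using Finset.mem_powerset.1 (Finset.mem_filter.1 hS).1 h
    rw [← Finset.erase_insert (key S hS), ← Finset.erase_insert (key T hT), h]
  have cardN : ∀ u ∈ A.filter (G.Adj v),
      ((N u).image fun S => insert v (insert u S)).card = (N u).card := by
    intro u hu
    refine Finset.card_image_of_injOn fun S hS T hT h => ?_
    have hS' := notMem u hu S hS
    have hT' := notMem u hu T hT
    rw [← Finset.erase_insert hS'.2, ← Finset.erase_insert hT'.2, ← Finset.erase_insert hS'.1,
      ← Finset.erase_insert hT'.1]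
    rw [h]
  have nbrs' : ∀ u ∈ A.filter (G.Adj v), ∀ S ∈ N u,
      (insert v (insert u S)).filter (G.Adj v) = {u} := by
    intro u hu S hS
    rw [Finset.filter_insert, if_neg (G.loopless.irrefl v), nbrs u hu S hS]
  rw [subsetCount, split, Finset.card_union_of_disjoint, Finset.card_union_of_disjoint, cardF,
    Finset.card_biUnion, Finset.sum_congr rfl cardN, ← add_assoc]
  · rfl
  · intro u hu w hw huw
    rw [Function.onFun, Finset.disjoint_left]
    intro S hS hS'
    obtain ⟨T, hT, rfl⟩ := Finset.mem_image.1 hS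
    obtain ⟨T', hT', h⟩ := Finset.mem_image.1 hS'
    have h1 := nbrs' u hu T hT
    rw [← h, nbrs' w hw T' hT'] at h1
    exact huw (Finset.singleton_injective h1).symm
  · rw [Finset.disjoint_left]
    intro S hS hS'
    obtain ⟨u, hu, hS'⟩ := Finset.mem_biUnion.1 hS'
    obtain ⟨T, hT, rfl⟩ := Finset.mem_image.1 hS
    obtain ⟨T', hT', h⟩ := Finset.mem_image.1 hS'
    have h1 := nbrs' u hu T' hT'
    rw [h, Finset.filter_insert, if_neg (G.loopless.irrefl v)] at h1
    have h2 : u ∈ T.filter (G.Adj v) := by simp [h1]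
    rw [Finset.mem_filter] at h2
    exact (Finset.mem_filter.1 (Finset.mem_powerset.1 (Finset.mem_filter.1 hT).1 h2.1)).2 h2.2
  · rw [Finset.disjoint_left]
    intro S hS hS'
    have hvS : v ∉ S := fun h => by
      simpa using Finset.mem_powerset.1 (Finset.mem_filter.1 hS).1 h
    simp only [Finset.mem_union, Finset.mem_image, Finset.mem_biUnion] at hS'
    rcases hS' with ⟨T, -, rfl⟩ | ⟨u, -, T, -, rfl⟩ <;> exact hvS (Finset.mem_insert_self _ _)

/-- The block of `m` consecutive elements of `Fin n` starting at `a`. -/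
def block (n a m : ℕ) : Finset (Fin n) :=
  Finset.univ.filter fun x => a ≤ x.val ∧ x.val < a + m

lemma mem_block {n a m : ℕ} {x : Fin n} : x ∈ block n a m ↔ a ≤ x.val ∧ x.val < a + m := by
  simp [block]

lemma tadpoleGraph_adj {n k : ℕ} {a b : Fin n} : (tadpoleGraph n k).Adj a b ↔ a.val ≠ b.val ∧
    (((a.val + 1 = b.val ∧ b.val < k) ∨ (a.val + 1 = b.val ∧ k ≤ a.val) ∨
      (a.val = k - 1 ∧ (b.val = k ∨ b.val = n - 1))) ∨
    ((b.val + 1 = a.val ∧ a.val < k) ∨ (b.val + 1 = a.val ∧ k ≤ b.val) ∨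
      (b.val = k - 1 ∧ (a.val = k ∨ a.val = n - 1)))) := by
  rw [tadpoleGraph, SimpleGraph.fromRel_adj, ne_eq, Fin.ext_iff]

/-- A block of vertices of the tadpole avoiding the vertex of degree `3` induces a path. -/
def pathEmbedding (n k a m : ℕ) (ham : a + m ≤ n) (h : a + m + 1 ≤ k ∨ k ≤ a) (hk : 1 ≤ k) :
    SimpleGraph.pathGraph m ↪g tadpoleGraph n k where
  toFun i := ⟨a + i.val, by omega⟩
  inj' i j hij := by simpa [Fin.ext_iff] using hij
  map_rel_iff' {i j} := by
    have hi := i.isLt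
    have hj := j.isLt
    rw [SimpleGraph.pathGraph_adj]
    refine tadpoleGraph_adj.trans ?_
    change a + i.val ≠ a + j.val ∧
      (((a + i.val + 1 = a + j.val ∧ a + j.val < k) ∨ (a + i.val + 1 = a + j.val ∧ k ≤ a + i.val) ∨
        (a + i.val = k - 1 ∧ (a + j.val = k ∨ a + j.val = n - 1))) ∨
      ((a + j.val + 1 = a + i.val ∧ a + i.val < k) ∨ (a + j.val + 1 = a + i.val ∧ k ≤ a + j.val) ∨
        (a + j.val = k - 1 ∧ (a + i.val = k ∨ a + i.val = n - 1)))) ↔ _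
    omega

lemma subsetCount_block {n k a m : ℕ} (ham : a + m ≤ n) (h : a + m + 1 ≤ k ∨ k ≤ a)
    (hk : 1 ≤ k) (j : ℕ) : subsetCount (tadpoleGraph n k) j (block n a m) =
      subsetCount (SimpleGraph.pathGraph m) j Finset.univ := by
  rw [← subsetCount_map (pathEmbedding n k a m ham h hk)]
  congr 1
  ext x
  simp only [mem_block, Finset.mem_map, Finset.mem_univ, true_and]
  constructor
  · rintro ⟨h1, h2⟩
    exact ⟨⟨x.val - a, by omega⟩, Fin.ext (Nat.add_sub_cancel' h1)⟩
  · rintro ⟨i, rfl⟩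
    exact ⟨Nat.le_add_right _ _, Nat.add_lt_add_left i.isLt a⟩

lemma disjoint_block {n a l b m : ℕ} (h : a + l ≤ b) : Disjoint (block n a l) (block n b m) := by
  rw [Finset.disjoint_left]
  simp only [mem_block]
  omega

lemma not_tadpoleGraph_adj_of_mem_block {n k a l b m : ℕ} (hal : a + l + 1 ≤ k) (hb : k ≤ b) :
    ∀ x ∈ block n a l, ∀ y ∈ block n b m, ¬ (tadpoleGraph n k).Adj x y := by
  simp only [mem_block, tadpoleGraph_adj]
  omega

lemma subsetCount_zero_block_union {n k a b l m : ℕ} (hal : a + l + 1 ≤ k) (hb : k ≤ b)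
    (hbm : b + m ≤ n) :
    subsetCount (tadpoleGraph n k) 0 (block n a l ∪ block n b m) =
      sigma0 (SimpleGraph.pathGraph l) * sigma0 (SimpleGraph.pathGraph m) := by
  rw [subsetCount_zero_union _ (disjoint_block (by omega))
      (not_tadpoleGraph_adj_of_mem_block hal hb), sigma0_eq_subsetCount, sigma0_eq_subsetCount,
    subsetCount_block (by omega) (.inl hal) (by omega), subsetCount_block hbm (.inr hb) (by omega)]

lemma subsetCount_one_block_union {n k a b l m : ℕ} (hal : a + l + 1 ≤ k) (hb : k ≤ b)
    (hbm : b + m ≤ n) :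
    subsetCount (tadpoleGraph n k) 1 (block n a l ∪ block n b m) =
      sigma1 (SimpleGraph.pathGraph l) * sigma0 (SimpleGraph.pathGraph m) +
      sigma1 (SimpleGraph.pathGraph m) * sigma0 (SimpleGraph.pathGraph l) := by
  simp only [subsetCount_one_union _ (disjoint_block (show a + l ≤ b by omega))
      (not_tadpoleGraph_adj_of_mem_block hal hb), sigma0_eq_subsetCount, sigma1_eq_subsetCount,
    subsetCount_block (show a + l ≤ n by omega) (.inl hal) (by omega),
    subsetCount_block hbm (.inr hb) (by omega)]

/-- For `k ≥ 2` and `n ≥ k + 2`, the tadpole graph satisfies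
`σ₁(Tₙᵏ) = σ₁(P_{k−1})σ₀(P_{n−k}) + σ₁(P_{n−k})σ₀(P_{k−1}) + σ₁(P_{k−2})σ₀(P_{n−k−2})
  + σ₁(P_{n−k−2})σ₀(P_{k−2}) + σ₀(P_{k−3})σ₀(P_{n−k−2}) + 2σ₀(P_{k−2})σ₀(P_{n−k−3})`.
(Here subtraction is truncated, which realises the conventions `σ₁(P_t) = 0` and
`σ₀(P_t) = 1` for `t ≤ 0`, since `σ₁(P₀) = 0` and `σ₀(P₀) = 1`.) -/
theorem sigma1_tadpoleGraph (n k : ℕ) (hk : 2 ≤ k) (hn : k + 2 ≤ n) :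
    sigma1 (tadpoleGraph n k) =
      sigma1 (SimpleGraph.pathGraph (k - 1)) * sigma0 (SimpleGraph.pathGraph (n - k)) +
      sigma1 (SimpleGraph.pathGraph (n - k)) * sigma0 (SimpleGraph.pathGraph (k - 1)) +
      sigma1 (SimpleGraph.pathGraph (k - 2)) * sigma0 (SimpleGraph.pathGraph (n - k - 2)) +
      sigma1 (SimpleGraph.pathGraph (n - k - 2)) * sigma0 (SimpleGraph.pathGraph (k - 2)) +
      sigma0 (SimpleGraph.pathGraph (k - 3)) * sigma0 (SimpleGraph.pathGraph (n - k - 2)) +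
      2 * sigma0 (SimpleGraph.pathGraph (k - 2)) * sigma0 (SimpleGraph.pathGraph (n - k - 3)) := by
  classical
  obtain ⟨v, hv⟩ : ∃ v : Fin n, v.val = k - 1 := ⟨⟨k - 1, by omega⟩, rfl⟩
  obtain ⟨p, hp⟩ : ∃ p : Fin n, p.val = k - 2 := ⟨⟨k - 2, by omega⟩, rfl⟩
  obtain ⟨q, hq⟩ : ∃ q : Fin n, q.val = k := ⟨⟨k, by omega⟩, rfl⟩
  obtain ⟨r, hr⟩ : ∃ r : Fin n, r.val = n - 1 := ⟨⟨n - 1, by omega⟩, rfl⟩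
  have hpq : p ≠ q := by rw [ne_eq, Fin.ext_iff]; omega
  have hpr : p ≠ r := by rw [ne_eq, Fin.ext_iff]; omega
  have hqr : q ≠ r := by rw [ne_eq, Fin.ext_iff]; omega
  have adj_v (x : Fin n) : (tadpoleGraph n k).Adj v x ↔
      x.val = k - 2 ∨ x.val = k ∨ x.val = n - 1 := by
    rw [tadpoleGraph_adj, hv]
    omega
  have adj_p (x : Fin n) : (tadpoleGraph n k).Adj p x ↔ x.val + 3 = k ∨ x.val = k - 1 := by
    rw [tadpoleGraph_adj, hp]
    omega
  have adj_q (x : Fin n) : (tadpoleGraph n k).Adj q x ↔ x.val = k + 1 ∨ x.val = k - 1 := by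
    rw [tadpoleGraph_adj, hq]
    omega
  have adj_r (x : Fin n) : (tadpoleGraph n k).Adj r x ↔ x.val + 2 = n ∨ x.val = k - 1 := by
    rw [tadpoleGraph_adj, hr]
    omega
  have nbrs : Finset.univ.filter ((tadpoleGraph n k).Adj v) = {p, q, r} := by
    ext x
    simp only [Finset.mem_filter, Finset.mem_univ, true_and, adj_v,
      Finset.mem_insert, Finset.mem_singleton, Fin.ext_iff]
    omega
  have rest : Finset.univ.erase v = block n 0 (k - 1) ∪ block n k (n - k) := by
    ext x
    simp only [ne_eq, and_true, Finset.mem_erase, Finset.mem_univ, Finset.mem_union, mem_block,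
      Fin.ext_iff]
    omega
  have restN : ((Finset.univ.erase v).filter fun x => ¬ (tadpoleGraph n k).Adj v x) =
      block n 0 (k - 2) ∪ block n (k + 1) (n - k - 2) := by
    ext x
    simp only [ne_eq, and_true, Finset.mem_filter, Finset.mem_erase, Finset.mem_univ, Finset.mem_union,
      mem_block, Fin.ext_iff, adj_v]
    omega
  have restP : (Finset.univ.filter fun x => x ≠ v ∧ ¬ (tadpoleGraph n k).Adj v x ∧ x ≠ p ∧
      ¬ (tadpoleGraph n k).Adj p x) = block n 0 (k - 3) ∪ block n (k + 1) (n - k - 2) := by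
    ext x
    simp only [ne_eq, true_and, Finset.mem_filter, Finset.mem_univ, Finset.mem_union,
      mem_block, Fin.ext_iff, adj_v, adj_p]
    omega
  have restQ : (Finset.univ.filter fun x => x ≠ v ∧ ¬ (tadpoleGraph n k).Adj v x ∧ x ≠ q ∧
      ¬ (tadpoleGraph n k).Adj q x) = block n 0 (k - 2) ∪ block n (k + 2) (n - k - 3) := by
    ext x
    simp only [ne_eq, true_and, Finset.mem_filter, Finset.mem_univ, Finset.mem_union,
      mem_block, Fin.ext_iff, adj_v, adj_q]
    omega
  have restR : (Finset.univ.filter fun x => x ≠ v ∧ ¬ (tadpoleGraph n k).Adj v x ∧ x ≠ r ∧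
      ¬ (tadpoleGraph n k).Adj r x) = block n 0 (k - 2) ∪ block n (k + 1) (n - k - 3) := by
    ext x
    simp only [ne_eq, true_and, Finset.mem_filter, Finset.mem_univ, Finset.mem_union,
      mem_block, Fin.ext_iff, adj_v, adj_r]
    omega
  rw [sigma1_eq_subsetCount, subsetCount_one_eq _ (Finset.mem_univ v), nbrs,
    Finset.sum_insert (by simp [hpq, hpr]), Finset.sum_pair hqr, restN, rest, restP, restQ, restR,
    subsetCount_one_block_union (by omega) (by omega) (by omega),
    subsetCount_one_block_union (by omega) (by omega) (by omega),
    subsetCount_zero_block_union (by omega) (by omega) (by omega),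
    subsetCount_zero_block_union (by omega) (by omega) (by omega),
    subsetCount_zero_block_union (by omega) (by omega) (by omega)]
  ring
end

section
/- If T is a tree of order n, then σ₁(T) ≥ n − 1, with equality if and only if T is isomorphic to the star K_{1,n−1}. -/
/-- The star `K_{1,n−1}` on `n` vertices: the centre `0` is adjacent to the `n−1`
leaves `1, …, n−1`, and there are no other edges. -/
def starGraph (n : ℕ) : SimpleGraph (Fin n) :=
  SimpleGraph.fromRel (fun a _ => a.val = 0)

/-- `G` is a star with centre `c` on its whole vertex set. -/
def IsStarAt {V : Type*} (G : SimpleGraph V) (c : V) : Prop :=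
  ∀ v w, G.Adj v w ↔ v ≠ w ∧ (v = c ∨ w = c)

theorem edgesWithin_coe_edge {V : Type*} {G : SimpleGraph V} {e : Sym2 V} (he : e ∈ G.edgeSet) :
    edgesWithin G (e : Set V) = {e} := by
  ext f
  simp only [edgesWithin, Set.mem_ofPred_eq, Set.mem_singleton_iff, SetLike.mem_coe]
  refine ⟨?_, by rintro rfl; exact ⟨he, fun _ h => h⟩⟩
  induction f with
  | h a b =>
    rintro ⟨hf, h⟩
    exact ((Sym2.mem_and_mem_iff (G.ne_of_adj hf)).mp
      ⟨h a (Sym2.mem_mk_left a b), h b (Sym2.mem_mk_right a b)⟩).symm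

theorem image_coe_edgeSet_subset {V : Type*} (G : SimpleGraph V) :
    (fun e : Sym2 V => (e : Set V)) '' G.edgeSet ⊆ {S | (edgesWithin G S).ncard = 1} := by
  rintro _ ⟨e, he, rfl⟩
  simp [edgesWithin_coe_edge he]

theorem ncard_image_coe_edgeSet {V : Type*} (G : SimpleGraph V) :
    ((fun e : Sym2 V => (e : Set V)) '' G.edgeSet).ncard = G.edgeSet.ncard :=
  Set.ncard_image_of_injective _ SetLike.coe_injective

theorem ncard_edgeSet_le_sigma1 {V : Type*} [Finite V] (G : SimpleGraph V) :
    G.edgeSet.ncard ≤ sigma1 G := by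
  rw [← ncard_image_coe_edgeSet]
  exact Set.ncard_le_ncard (image_coe_edgeSet_subset G)

theorem sigma1_eq_ncard_edgeSet_iff {V : Type*} [Finite V] (G : SimpleGraph V) :
    sigma1 G = G.edgeSet.ncard ↔
      ∀ S : Set V, (edgesWithin G S).ncard = 1 → ∃ e ∈ G.edgeSet, (e : Set V) = S := by
  rw [← ncard_image_coe_edgeSet]
  constructor
  · intro h S hS
    have := Set.eq_of_subset_of_ncard_le (image_coe_edgeSet_subset G) h.le
    exact this.ge hS
  · intro h
    exact congrArg Set.ncard ((image_coe_edgeSet_subset G).antisymm h).symm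

theorem IsStarAt.sigma1_eq_ncard_edgeSet {V : Type*} [Finite V] {G : SimpleGraph V} {c : V}
    (h : IsStarAt G c) : sigma1 G = G.edgeSet.ncard := by
  refine (sigma1_eq_ncard_edgeSet_iff G).mpr fun S hS => ?_
  obtain ⟨e, he⟩ := Set.ncard_eq_one.mp hS
  have heS : e ∈ edgesWithin G S := by simp [he]
  refine ⟨e, heS.1, Set.Subset.antisymm heS.2 fun y hy => ?_⟩
  have hc : c ∈ e := by
    have h1 := heS.1
    induction e with
    | h a b => rcases ((h a b).mp h1).2 with rfl | rfl <;> simp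
  by_cases hyc : y = c
  · exact hyc ▸ hc
  · have : s(c, y) ∈ edgesWithin G S :=
      ⟨(h c y).mpr ⟨Ne.symm hyc, .inl rfl⟩, by
        simpa using ⟨heS.2 c hc, hy⟩⟩
    rw [he, Set.mem_singleton_iff] at this
    simp [← this]

theorem adj_or_adj_of_sigma1_eq {V : Type*} [Finite V] {G : SimpleGraph V}
    (h : sigma1 G = G.edgeSet.ncard) {u v w : V} (huv : G.Adj u v) (hwu : w ≠ u) (hwv : w ≠ v) :
    G.Adj w u ∨ G.Adj w v := by
  by_contra! hw
  have hS : edgesWithin G {u, v, w} = {s(u, v)} := by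
    ext f
    induction f with
    | h a b =>
      simp only [edgesWithin, Set.mem_ofPred_eq, SimpleGraph.mem_edgeSet, Sym2.mem_iff,
        forall_eq_or_imp, forall_eq, Set.mem_insert_iff, Set.mem_singleton_iff, Sym2.eq_iff]
      constructor
      · rintro ⟨hab, rfl | rfl | rfl, rfl | rfl | rfl⟩ <;> simp_all [G.adj_comm]
      · rintro (⟨rfl, rfl⟩ | ⟨rfl, rfl⟩) <;> simp [huv, huv.symm]
  obtain ⟨e, he, heS⟩ := (sigma1_eq_ncard_edgeSet_iff G).mp h {u, v, w} (by simp [hS])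
  have heq : e = s(u, v) := by
    rw [← Set.mem_singleton_iff, ← hS, ← heS, edgesWithin_coe_edge he]
    rfl
  have hmem : w ∈ (e : Set V) := by simp [heS]
  rw [heq] at hmem
  simp [hwu, hwv] at hmem

theorem SimpleGraph.IsAcyclic.not_triangle {V : Type*} {G : SimpleGraph V} (hG : G.IsAcyclic)
    {a b c : V} (hab : G.Adj a b) (hbc : G.Adj b c) : ¬ G.Adj c a := fun hca =>
  hG (.cons hab (.cons hbc (.cons hca .nil))) <| by
    have := hab.ne
    have := hbc.ne
    have := hca.ne
    simp [SimpleGraph.Walk.cons_isCycle_iff]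
    grind

theorem SimpleGraph.IsAcyclic.not_square {V : Type*} {G : SimpleGraph V} (hG : G.IsAcyclic)
    {a b c d : V} (hac : a ≠ c) (hbd : b ≠ d) (hab : G.Adj a b) (hbc : G.Adj b c)
    (hcd : G.Adj c d) : ¬ G.Adj d a := fun hda =>
  hG (.cons hab (.cons hbc (.cons hcd (.cons hda .nil)))) <| by
    have := hab.ne
    have := hbc.ne
    have := hcd.ne
    have := hda.ne
    simp [SimpleGraph.Walk.cons_isCycle_iff]
    grind

theorem SimpleGraph.IsAcyclic.isStarAt {V : Type*} {G : SimpleGraph V} (hG : G.IsAcyclic) {c : V}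
    (hc : ∀ w, w ≠ c → G.Adj w c) : IsStarAt G c := by
  intro v w
  constructor
  · intro hvw
    refine ⟨hvw.ne, ?_⟩
    by_contra! h
    exact hG.not_triangle hvw (hc w h.2) (hc v h.1).symm
  · rintro ⟨hne, rfl | rfl⟩
    · exact (hc w hne.symm).symm
    · exact hc v hne

theorem SimpleGraph.IsTree.exists_isStarAt {V : Type*} [Finite V] {T : SimpleGraph V}
    (hT : T.IsTree) (h : sigma1 T = T.edgeSet.ncard) : ∃ c, IsStarAt T c := by
  have hG : T.IsAcyclic := hT.isAcyclic
  obtain ⟨x⟩ := hT.connected.nonempty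
  by_cases hx : ∃ y, T.Adj x y
  · obtain ⟨y, hxy⟩ := hx
    by_contra! hno
    obtain ⟨a, hax, ha⟩ : ∃ a, a ≠ x ∧ ¬ T.Adj a x := by
      by_contra! hc
      exact hno x (hG.isStarAt hc)
    obtain ⟨b, hby, hb⟩ : ∃ b, b ≠ y ∧ ¬ T.Adj b y := by
      by_contra! hc
      exact hno y (hG.isStarAt hc)
    have hay : a ≠ y := fun e => ha (e ▸ hxy.symm)
    have hbx : b ≠ x := fun e => hb (e ▸ hxy)
    have hTay : T.Adj a y := (adj_or_adj_of_sigma1_eq h hxy hax hay).resolve_left ha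
    have hTbx : T.Adj b x := (adj_or_adj_of_sigma1_eq h hxy hbx hby).resolve_right hb
    have hba : b ≠ a := fun e => hb (e ▸ hTay)
    rcases adj_or_adj_of_sigma1_eq h hTay hba hby with hTba | hTby
    · exact hG.not_square hax.symm hby.symm hxy hTay.symm hTba.symm hTbx
    · exact hb hTby
  · push Not at hx
    refine ⟨x, hG.isStarAt fun w hw => ?_⟩
    have : Nontrivial V := ⟨w, x, hw⟩
    obtain ⟨y, hy⟩ := hT.connected.preconnected.exists_adj_of_nontrivial x
    exact absurd hy (hx y)

theorem starGraph_adj {n : ℕ} {a b : Fin n} :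
    (starGraph n).Adj a b ↔ a ≠ b ∧ (a.val = 0 ∨ b.val = 0) := by
  simp [starGraph]

theorem exists_isStarAt_iff_nonempty_iso {V : Type*} [Fintype V] [Nonempty V]
    (G : SimpleGraph V) :
    (∃ c, IsStarAt G c) ↔ Nonempty (G ≃g starGraph (Fintype.card V)) := by
  constructor
  · rintro ⟨c, hc⟩
    let z : Fin (Fintype.card V) := ⟨0, Fintype.card_pos⟩
    let f := (Fintype.equivFin V).trans (Equiv.swap (Fintype.equivFin V c) z)
    have hz : ∀ v, (f v).val = 0 ↔ v = c := fun v => by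
      have hfc : f c = z := by simp [f]
      rw [← f.injective.eq_iff, hfc, Fin.ext_iff]
    exact ⟨f, by intro a b; rw [starGraph_adj, hz, hz, f.injective.ne_iff, hc a b]⟩
  · rintro ⟨f⟩
    have hz : ∀ v, (f v).val = 0 ↔ v = f.symm ⟨0, Fintype.card_pos⟩ := fun v => by
      rw [← f.injective.eq_iff, f.apply_symm_apply, Fin.ext_iff]
    exact ⟨f.symm ⟨0, Fintype.card_pos⟩, fun v w => by
      rw [← f.map_adj_iff, starGraph_adj, hz, hz, f.injective.ne_iff]⟩

/-- If `T` is a tree of order `n`, then `σ₁(T) ≥ n − 1`, with equality if and only if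
`T` is isomorphic to the star `K_{1,n−1}`. -/
theorem sigma1_tree_ge_card_sub_one {V : Type*} [Fintype V] (T : SimpleGraph V)
    (hT : T.IsTree) :
    Fintype.card V - 1 ≤ sigma1 T ∧
      (sigma1 T = Fintype.card V - 1 ↔ Nonempty (T ≃g starGraph (Fintype.card V))) := by
  classical
  have : Nonempty V := hT.connected.nonempty
  have hcard : T.edgeSet.ncard = Fintype.card V - 1 := by
    rw [← hT.card_edgeFinset, ← SimpleGraph.coe_edgeFinset, Set.ncard_coe_finset]
    simp
  rw [← hcard, ← exists_isStarAt_iff_nonempty_iso]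
  exact ⟨ncard_edgeSet_le_sigma1 T, hT.exists_isStarAt,
    fun ⟨_, hc⟩ => hc.sigma1_eq_ncard_edgeSet⟩
end
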